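/- arXiv:1108.4181 — 2 statements merged into one kernel-verified Lean document; each statement's English description precedes it below -/
import Mathlib

section
/- Uniqueness of interface values: if the full block-tridiagonal matrix P is invertible and for each subinterval the homogeneous boundary value problems defining U_i, V_i have unique solutions, then the reduced interface matrix P̃ of block order p (with diagonal blocks C_K - A_K V_{K-1} - B_K U_{K+1} and off-diagonal blocks -A_K U_{K-1}, -B_K V_{K+1}) is invertible. -/
/-- Invertibility of the reduced interface matrix `P̃`.  `N = p*L`; the
subintervals are numbered `k = 1,…,p` and cover `[(k-1)*L+1, k*L+1]`, with interface
blocks `K = (k-1)*L+1`.  The full block-tridiagonal matrix `P` is invertible (`hinvP`,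
unique solvability with the conventions `X 0 = 0`, `X j = 0` for `j > N`, `A 1 = 0`,
`B N = 0`), and on each subinterval the boundary value problems defining `U k`, `V k`
are uniquely solvable (`hbvp`).  Then the reduced block-tridiagonal matrix `P̃` of block
order `p` — diagonal blocks `C K - A K * V (k-1) (K-1) - B K * U k (K+1)`, subdiagonal
blocks `-(A K * U (k-1) (K-1))`, superdiagonal blocks `-(B K * V k (K+1))` — is
invertible, i.e. the reduced system is uniquely solvable for every right-hand side. -/
theorem stmt10 (M L p N : ℕ) (hL : 1 ≤ L) (hp : 1 ≤ p) (hN : N = p * L)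
    (A B C : ℕ → Matrix (Fin M) (Fin M) ℝ)
    (U V : ℕ → ℕ → Matrix (Fin M) (Fin M) ℝ)
    (hA1 : A 1 = 0) (hBN : B N = 0)
    (hinvP : ∀ G : ℕ → Fin M → ℝ, ∃! X : ℕ → Fin M → ℝ,
      (∀ j, j = 0 ∨ N < j → X j = 0) ∧
      ∀ j, 1 ≤ j → j ≤ N →
        -(A j).mulVec (X (j - 1)) + (C j).mulVec (X j) - (B j).mulVec (X (j + 1)) = G j)
    (hUbc : ∀ k, 1 ≤ k → k ≤ p → U k ((k - 1) * L + 1) = 1 ∧ U k (k * L + 1) = 0)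
    (hVbc : ∀ k, 1 ≤ k → k ≤ p → V k ((k - 1) * L + 1) = 0 ∧ V k (k * L + 1) = 1)
    (hUrec : ∀ k, 1 ≤ k → k ≤ p → ∀ i, (k - 1) * L + 1 < i → i < k * L + 1 →
        -(A i) * U k (i - 1) + C i * U k i - B i * U k (i + 1) = 0)
    (hVrec : ∀ k, 1 ≤ k → k ≤ p → ∀ i, (k - 1) * L + 1 < i → i < k * L + 1 →
        -(A i) * V k (i - 1) + C i * V k i - B i * V k (i + 1) = 0)
    (hbvp : ∀ k, 1 ≤ k → k ≤ p → ∀ (g : ℕ → Fin M → ℝ) (yl yr : Fin M → ℝ),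
      ∃! Y : ℕ → Fin M → ℝ,
        (∀ i, i < (k - 1) * L + 1 ∨ k * L + 1 < i → Y i = 0) ∧
        Y ((k - 1) * L + 1) = yl ∧ Y (k * L + 1) = yr ∧
        ∀ i, (k - 1) * L + 1 < i → i < k * L + 1 →
          -(A i).mulVec (Y (i - 1)) + (C i).mulVec (Y i) - (B i).mulVec (Y (i + 1)) = g i) :
    ∀ G : ℕ → Fin M → ℝ, ∃! y : ℕ → Fin M → ℝ,
      (∀ k, k = 0 ∨ p < k → y k = 0) ∧
      ∀ k, 1 ≤ k → k ≤ p →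
        -(A ((k - 1) * L + 1) * U (k - 1) ((k - 1) * L)).mulVec (y (k - 1)) +
          (C ((k - 1) * L + 1) - A ((k - 1) * L + 1) * V (k - 1) ((k - 1) * L)
            - B ((k - 1) * L + 1) * U k ((k - 1) * L + 2)).mulVec (y k) -
          (B ((k - 1) * L + 1) * V k ((k - 1) * L + 2)).mulVec (y (k + 1)) = G k := by
  classical
  -- arithmetic of the interfaces
  have hK : ∀ k, 1 ≤ k → (k - 1) * L + L = k * L := by
    intro k hk
    obtain ⟨m, rfl⟩ : ∃ m, k = m + 1 := ⟨k - 1, by omega⟩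
    simp [Nat.add_mul]
  have hKp : ∀ k, k ≤ p → k * L ≤ N := by
    intro k hk
    rw [hN]
    exact Nat.mul_le_mul_right L hk
  -- full row at an interface equals the reduced row
  have key : ∀ (X y : ℕ → Fin M → ℝ),
      (∀ k, 1 ≤ k → k ≤ p → ∀ j, (k - 1) * L + 1 ≤ j → j ≤ k * L + 1 →
        X j = (U k j).mulVec (y k) + (V k j).mulVec (y (k + 1))) →
      ∀ k, 1 ≤ k → k ≤ p →
        -(A ((k - 1) * L + 1)).mulVec (X ((k - 1) * L + 1 - 1))
          + (C ((k - 1) * L + 1)).mulVec (X ((k - 1) * L + 1))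
          - (B ((k - 1) * L + 1)).mulVec (X ((k - 1) * L + 1 + 1)) =
        -(A ((k - 1) * L + 1) * U (k - 1) ((k - 1) * L)).mulVec (y (k - 1)) +
          (C ((k - 1) * L + 1) - A ((k - 1) * L + 1) * V (k - 1) ((k - 1) * L)
            - B ((k - 1) * L + 1) * U k ((k - 1) * L + 2)).mulVec (y k) -
          (B ((k - 1) * L + 1) * V k ((k - 1) * L + 2)).mulVec (y (k + 1)) := by
    intro X y hX k hk1 hkp
    have e1 := hK k hk1
    have h0 : X ((k - 1) * L + 1) = y k := by
      rw [hX k hk1 hkp _ le_rfl (by omega), (hUbc k hk1 hkp).1, (hVbc k hk1 hkp).1]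
      simp
    have h2 := hX k hk1 hkp ((k - 1) * L + 2) (by omega) (by omega)
    have hl : (A ((k - 1) * L + 1)).mulVec (X ((k - 1) * L)) =
        (A ((k - 1) * L + 1) * U (k - 1) ((k - 1) * L)).mulVec (y (k - 1)) +
        (A ((k - 1) * L + 1) * V (k - 1) ((k - 1) * L)).mulVec (y k) := by
      rcases Nat.eq_or_lt_of_le hk1 with h | h
      · subst h
        simp [hA1]
      · have e2 := hK (k - 1) (by omega)
        have := hX (k - 1) (by omega) (by omega) ((k - 1) * L) (by omega) (by omega)
        rw [this, Nat.sub_add_cancel hk1, Matrix.mulVec_add, Matrix.mulVec_mulVec,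
          Matrix.mulVec_mulVec]
    rw [Nat.add_sub_cancel, hl, h0, show (k - 1) * L + 1 + 1 = (k - 1) * L + 2 from rfl, h2]
    simp only [Matrix.sub_mulVec, Matrix.mulVec_add, Matrix.mulVec_mulVec]
    abel
  -- interior rows vanish on combinations of U and V
  have inter : ∀ k, 1 ≤ k → k ≤ p → ∀ (a b : Fin M → ℝ) i, (k - 1) * L + 1 < i → i < k * L + 1 →
      -(A i).mulVec ((U k (i - 1)).mulVec a + (V k (i - 1)).mulVec b)
        + (C i).mulVec ((U k i).mulVec a + (V k i).mulVec b)
        - (B i).mulVec ((U k (i + 1)).mulVec a + (V k (i + 1)).mulVec b) = 0 := by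
    intro k hk1 hkp a b i hi1 hi2
    have hu := congrArg (fun T => T.mulVec a) (hUrec k hk1 hkp i hi1 hi2)
    have hv := congrArg (fun T => T.mulVec b) (hVrec k hk1 hkp i hi1 hi2)
    simp only [Matrix.sub_mulVec, Matrix.add_mulVec, Matrix.neg_mul, Matrix.neg_mulVec,
      Matrix.zero_mulVec] at hu hv
    have := congrArg₂ (· + ·) hu hv
    simp only [add_zero] at this
    rw [← this]
    simp only [Matrix.mulVec_add, Matrix.mulVec_mulVec]
    abel
  -- every row is located in a subinterval
  have loc : ∀ j, 1 ≤ j → j ≤ N → ∃ k, k = (j - 1) / L + 1 ∧ 1 ≤ k ∧ k ≤ p ∧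
      (k - 1) * L + 1 ≤ j ∧ j < k * L + 1 := by
    intro j hj1 hjN
    have hd := Nat.div_add_mod (j - 1) L
    have hm := Nat.mod_lt (j - 1) (show 0 < L by omega)
    have hlt : (j - 1) / L < p := by
      rw [Nat.div_lt_iff_lt_mul (by omega), ← hN]
      omega
    refine ⟨_, rfl, Nat.succ_pos _, hlt, ?_, ?_⟩
    · rw [Nat.add_sub_cancel, Nat.mul_comm]
      omega
    · rw [Nat.add_mul, Nat.mul_comm]
      omega
  intro G
  -- right-hand side of the full system
  let H : ℕ → Fin M → ℝ := fun j => if L ∣ (j - 1) then G ((j - 1) / L + 1) else 0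
  have H1 : ∀ k, 1 ≤ k → H ((k - 1) * L + 1) = G k := by
    intro k hk
    have : (k - 1) * L / L = k - 1 := Nat.mul_div_cancel _ (by omega)
    simp [H, this, Nat.sub_add_cancel hk]
  have H2 : ∀ k, 1 ≤ k → ∀ i, (k - 1) * L + 1 < i → i < k * L + 1 → H i = 0 := by
    intro k hk i hi1 hi2
    have e1 := hK k hk
    have : ¬ L ∣ (i - 1) := by
      rintro ⟨c, hc⟩
      rw [Nat.mul_comm] at hc
      have a1 : k - 1 < c := Nat.lt_of_mul_lt_mul_right (a := L) (by omega)
      have a2 : c < k := Nat.lt_of_mul_lt_mul_right (a := L) (by omega)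
      omega
    simp [H, this]
  obtain ⟨X, ⟨hX0, hXe⟩, hXu⟩ := hinvP H
  -- any reduced solution extends to the full solution
  have ext : ∀ y : ℕ → Fin M → ℝ, ((∀ k, k = 0 ∨ p < k → y k = 0) ∧
      ∀ k, 1 ≤ k → k ≤ p →
        -(A ((k - 1) * L + 1) * U (k - 1) ((k - 1) * L)).mulVec (y (k - 1)) +
          (C ((k - 1) * L + 1) - A ((k - 1) * L + 1) * V (k - 1) ((k - 1) * L)
            - B ((k - 1) * L + 1) * U k ((k - 1) * L + 2)).mulVec (y k) -
          (B ((k - 1) * L + 1) * V k ((k - 1) * L + 2)).mulVec (y (k + 1)) = G k) →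
      ∀ k, 1 ≤ k → k ≤ p → y k = X ((k - 1) * L + 1) := by
    rintro y ⟨hy0, hye⟩
    let Z : ℕ → Fin M → ℝ := fun j => if j = 0 ∨ N < j then 0 else
      (U ((j - 1) / L + 1) j).mulVec (y ((j - 1) / L + 1)) +
      (V ((j - 1) / L + 1) j).mulVec (y ((j - 1) / L + 1 + 1))
    have hZlow : ∀ k, 1 ≤ k → k ≤ p → ∀ j, (k - 1) * L + 1 ≤ j → j < k * L + 1 →
        Z j = (U k j).mulVec (y k) + (V k j).mulVec (y (k + 1)) := by
      intro k hk1 hkp j hj1 hj2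
      have e1 := hK k hk1
      have e2 := hKp k hkp
      have : (j - 1) / L = k - 1 := by
        apply Nat.div_eq_of_lt_le
        · omega
        · rw [Nat.sub_add_cancel hk1]
          omega
      have hn : ¬ (j = 0 ∨ N < j) := by omega
      simp only [Z, if_neg hn, this, Nat.sub_add_cancel hk1]
    have hZint : ∀ k, 1 ≤ k → k ≤ p → Z ((k - 1) * L + 1) = y k := by
      intro k hk1 hkp
      have e1 := hK k hk1
      rw [hZlow k hk1 hkp _ le_rfl (by omega), (hUbc k hk1 hkp).1, (hVbc k hk1 hkp).1]
      simp
    have hZ : ∀ k, 1 ≤ k → k ≤ p → ∀ j, (k - 1) * L + 1 ≤ j → j ≤ k * L + 1 →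
        Z j = (U k j).mulVec (y k) + (V k j).mulVec (y (k + 1)) := by
      intro k hk1 hkp j hj1 hj2
      rcases Nat.lt_or_eq_of_le hj2 with h | h
      · exact hZlow k hk1 hkp j hj1 h
      · subst h
        rw [(hUbc k hk1 hkp).2, (hVbc k hk1 hkp).2]
        simp only [Matrix.zero_mulVec, Matrix.one_mulVec, zero_add]
        rcases Nat.lt_or_eq_of_le hkp with h | h
        · have := hZint (k + 1) (by omega) (by omega)
          simpa using this
        · subst h
          rw [hy0 (k + 1) (by omega)]
          have : k * L + 1 = 0 ∨ N < k * L + 1 := by omega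
          simp only [Z, if_pos this]
    have hZX : Z = X := by
      apply hXu
      refine ⟨fun j hj => by simp only [Z, if_pos hj], ?_⟩
      intro j hj1 hjN
      obtain ⟨k, -, hk1, hkp, h1, h2⟩ := loc j hj1 hjN
      rcases Nat.eq_or_lt_of_le h1 with h | h
      · subst h
        rw [key Z y hZ k hk1 hkp, H1 k hk1]
        exact hye k hk1 hkp
      · rw [hZ k hk1 hkp (j - 1) (by omega) (by omega), hZ k hk1 hkp j (by omega) (by omega),
          hZ k hk1 hkp (j + 1) (by omega) (by omega), H2 k hk1 j h h2]
        exact inter k hk1 hkp _ _ j h h2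
    intro k hk1 hkp
    rw [← hZX, hZint k hk1 hkp]
  let y : ℕ → Fin M → ℝ := fun k => if k = 0 ∨ p < k then 0 else X ((k - 1) * L + 1)
  have hy : ∀ k, 1 ≤ k → k ≤ p + 1 → y k = X ((k - 1) * L + 1) := by
    intro k hk1 hkp
    by_cases h : p < k
    · have hk : k = p + 1 := by omega
      subst hk
      rw [hX0 ((p + 1 - 1) * L + 1) (by rw [Nat.add_sub_cancel]; omega)]
      simp [y]
    · have hn : ¬ (k = 0 ∨ p < k) := by omega
      simp only [y, if_neg hn]
  have hXF : ∀ k, 1 ≤ k → k ≤ p → ∀ j, (k - 1) * L + 1 ≤ j → j ≤ k * L + 1 →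
        X j = (U k j).mulVec (y k) + (V k j).mulVec (y (k + 1)) := by
    intro k hk1 hkp
    have e1 := hK k hk1
    have e2 := hKp k hkp
    let Y1 : ℕ → Fin M → ℝ := fun i => if i < (k - 1) * L + 1 ∨ k * L + 1 < i then 0 else X i
    let Y2 : ℕ → Fin M → ℝ := fun i => if i < (k - 1) * L + 1 ∨ k * L + 1 < i then 0 else
      (U k i).mulVec (y k) + (V k i).mulVec (y (k + 1))
    have g1 : ∀ j, (k - 1) * L + 1 ≤ j → j ≤ k * L + 1 → Y1 j = X j := by
      intro j a b
      have hn : ¬ (j < (k - 1) * L + 1 ∨ k * L + 1 < j) := by omega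
      simp only [Y1, if_neg hn]
    have g2 : ∀ j, (k - 1) * L + 1 ≤ j → j ≤ k * L + 1 →
        Y2 j = (U k j).mulVec (y k) + (V k j).mulVec (y (k + 1)) := by
      intro j a b
      have hn : ¬ (j < (k - 1) * L + 1 ∨ k * L + 1 < j) := by omega
      simp only [Y2, if_neg hn]
    have hEq : Y1 = Y2 := by
      apply (hbvp k hk1 hkp (fun _ => 0) (y k) (y (k + 1))).unique
      · refine ⟨fun i hi => by simp only [Y1, if_pos hi], ?_, ?_, ?_⟩
        · rw [g1 _ le_rfl (by omega), hy k hk1 (by omega)]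
        · rw [g1 _ (by omega) le_rfl, hy (k + 1) (by omega) (by omega), Nat.add_sub_cancel]
        · intro i hi1 hi2
          rw [g1 (i - 1) (by omega) (by omega), g1 i (by omega) (by omega),
            g1 (i + 1) (by omega) (by omega), hXe i (by omega) (by omega), H2 k hk1 i hi1 hi2]
      · refine ⟨fun i hi => by simp only [Y2, if_pos hi], ?_, ?_, ?_⟩
        · rw [g2 _ le_rfl (by omega), (hUbc k hk1 hkp).1, (hVbc k hk1 hkp).1]
          simp
        · rw [g2 _ (by omega) le_rfl, (hUbc k hk1 hkp).2, (hVbc k hk1 hkp).2]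
          simp
        · intro i hi1 hi2
          rw [g2 (i - 1) (by omega) (by omega), g2 i (by omega) (by omega),
            g2 (i + 1) (by omega) (by omega)]
          exact inter k hk1 hkp _ _ i hi1 hi2
    intro j a b
    rw [← g1 j a b, hEq, g2 j a b]
  refine ⟨y, ⟨fun k hk => by simp only [y, if_pos hk], ?_⟩, ?_⟩
  · intro k hk1 hkp
    have e1 := hK k hk1
    have e2 := hKp k hkp
    rw [← key X y hXF k hk1 hkp, hXe _ (by omega) (by omega), H1 k hk1]
  · intro y' hy'
    funext k
    by_cases h : k = 0 ∨ p < k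
    · rw [hy'.1 k h]
      simp only [y, if_pos h]
    · rw [ext y' hy' k (by omega) (by omega), hy k (by omega) (by omega)]
end

section
/- If every diagonal block C_j of a block-tridiagonal matrix P is invertible and the matrix is block strictly diagonally dominant in the sense that ‖C_j^{-1}‖·(‖A_j‖ + ‖B_j‖) < 1 for all j (with A_1 = B_N = 0) in the operator norm, then P is invertible. -/
/-- The `NM × NM` block-tridiagonal matrix with `M × M` diagonal blocks `C j`,
subdiagonal blocks `-A j` and superdiagonal blocks `-B j` (blocks numbered `1,…,N`). -/
def blockTri (N M : ℕ) (A B C : ℕ → Matrix (Fin M) (Fin M) ℝ) :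
    Matrix (Fin N × Fin M) (Fin N × Fin M) ℝ := fun p q =>
  if (p.1 : ℕ) = (q.1 : ℕ) then C ((p.1 : ℕ) + 1) p.2 q.2
  else if (p.1 : ℕ) = (q.1 : ℕ) + 1 then -(A ((p.1 : ℕ) + 1) p.2 q.2)
  else if (q.1 : ℕ) = (p.1 : ℕ) + 1 then -(B ((p.1 : ℕ) + 1) p.2 q.2)
  else 0

/-- The operator norm of an `M × M` real matrix, induced by the Euclidean norm on `ℝ^M`. -/
noncomputable def opN (M : ℕ) (T : Matrix (Fin M) (Fin M) ℝ) : ℝ :=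
  ‖(Matrix.toEuclideanLin T).toContinuousLinearMap‖

lemma opN_le (M : ℕ) (T : Matrix (Fin M) (Fin M) ℝ) (x : Fin M → ℝ) :
    ‖WithLp.toLp 2 (T.mulVec x)‖ ≤ opN M T * ‖WithLp.toLp 2 x‖ := by
  have := (Matrix.toEuclideanLin T).toContinuousLinearMap.le_opNorm (WithLp.toLp 2 x)
  simpa [opN, Matrix.toLpLin_toLp] using this

lemma opN_nonneg (M : ℕ) (T : Matrix (Fin M) (Fin M) ℝ) : 0 ≤ opN M T := norm_nonneg _

/-- Row `i` of `P v = 0`. -/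
lemma blockTri_row (N M : ℕ) (A B C : ℕ → Matrix (Fin M) (Fin M) ℝ)
    (u : ℕ → Fin M → ℝ) (hu : ∀ k, N ≤ k → u k = 0)
    (h : (blockTri N M A B C).mulVec (fun p => u p.1 p.2) = 0) (i : ℕ) (hi : i < N) :
    (C (i + 1)).mulVec (u i) =
      (A (i + 1)).mulVec (if i = 0 then 0 else u (i - 1)) + (B (i + 1)).mulVec (u (i + 1)) := by
  ext a
  have h1 := congrFun h (⟨i, hi⟩, a)
  simp only [Matrix.mulVec, dotProduct, Fintype.sum_prod_type, Pi.zero_apply] at h1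
  have h2 : ∀ k : Fin N, (∑ b, blockTri N M A B C (⟨i, hi⟩, a) (k, b) * u k b) =
      (fun k : ℕ => (if k = i then (C (i + 1)).mulVec (u k) a else 0)
        - (if k + 1 = i then (A (i + 1)).mulVec (u k) a else 0)
        - (if k = i + 1 then (B (i + 1)).mulVec (u k) a else 0)) k := by
    intro k
    simp only [blockTri, Matrix.mulVec, dotProduct]
    by_cases c1 : i = k
    · have : ¬ ((k : ℕ) + 1 = i) := by omega
      have : ¬ ((k : ℕ) = i + 1) := by omega
      simp [← c1]
    by_cases c2 : i = k + 1
    · have e1 : ¬ ((k : ℕ) = i) := by omega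
      have e2 : ¬ ((k : ℕ) = i + 1) := by omega
      have e3 : (k : ℕ) + 1 = i := by omega
      rw [if_neg e1, if_neg e2, if_pos e3]
      simp [c1, ← c2]
    by_cases c3 : (k : ℕ) = i + 1
    · have e1 : ¬ ((k : ℕ) = i) := by omega
      have e3 : ¬ ((k : ℕ) + 1 = i) := by omega
      rw [if_neg e1, if_pos c3, if_neg e3]
      simp only [if_neg c1, if_neg c2, if_pos c3]
      simp
    · have e1 : ¬ ((k : ℕ) = i) := by omega
      have e3 : ¬ ((k : ℕ) + 1 = i) := by omega
      simp [c1, c2, c3, e1, e3]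
  rw [Finset.sum_congr rfl (fun k _ => h2 k)] at h1
  replace h1 := (Fin.sum_univ_eq_sum_range (fun k : ℕ =>
        (if k = i then (C (i + 1)).mulVec (u k) a else 0)
        - (if k + 1 = i then (A (i + 1)).mulVec (u k) a else 0)
        - (if k = i + 1 then (B (i + 1)).mulVec (u k) a else 0)) N).symm.trans h1
  rw [Finset.sum_sub_distrib,
    Finset.sum_sub_distrib, Finset.sum_ite_eq', Finset.sum_ite_eq',
    if_pos (Finset.mem_range.2 hi)] at h1
  have h3 : (if i + 1 ∈ Finset.range N then (B (i + 1)).mulVec (u (i + 1)) a else 0)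
      = (B (i + 1)).mulVec (u (i + 1)) a := by
    split_ifs with c
    · rfl
    · rw [hu _ (by simpa using c)]; simp
  have h4 : (∑ k ∈ Finset.range N, if k + 1 = i then (A (i + 1)).mulVec (u k) a else 0)
      = (A (i + 1)).mulVec (if i = 0 then 0 else u (i - 1)) a := by
    rcases i with _ | i
    · simp
    · simp only [add_left_inj, Finset.sum_ite_eq']
      rw [if_pos (Finset.mem_range.2 (by omega))]
      simp
  rw [h3, h4] at h1
  simp only [Pi.add_apply]
  linarith

/-- If every diagonal block `C j` of the block-tridiagonal matrix `P` is
invertible and `P` is block strictly diagonally dominant,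
`‖(C j)⁻¹‖ (‖A j‖ + ‖B j‖) < 1` for all `j` (with `A 1 = 0`, `B N = 0`) in the operator
norm induced by the Euclidean norm, then `P` is invertible. -/
theorem stmt12 (N M : ℕ) (hN : 1 ≤ N)
    (A B C : ℕ → Matrix (Fin M) (Fin M) ℝ)
    (hA1 : A 1 = 0) (hBN : B N = 0)
    (hC : ∀ j, 1 ≤ j → j ≤ N → IsUnit (C j))
    (hdom : ∀ j, 1 ≤ j → j ≤ N → opN M (C j)⁻¹ * (opN M (A j) + opN M (B j)) < 1) :
    IsUnit (blockTri N M A B C) := by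
  rw [← Matrix.mulVec_injective_iff_isUnit]
  rw [← Matrix.coe_mulVecLin, ← LinearMap.ker_eq_bot, LinearMap.ker_eq_bot']
  intro v hv
  rw [Matrix.mulVecLin_apply] at hv
  let u : ℕ → Fin M → ℝ := fun k b => if h : k < N then v (⟨k, h⟩, b) else 0
  have huv : (fun p : Fin N × Fin M => u p.1 p.2) = v := by
    ext p; simp [u]
  have hu : ∀ k, N ≤ k → u k = 0 := by
    intro k hk; ext b; simp [u, not_lt.2 hk]
  have hrow := blockTri_row N M A B C u hu (by rw [huv]; exact hv)
  obtain ⟨i, hi, hmax⟩ := Finset.exists_max_image (Finset.range N)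
    (fun k => ‖WithLp.toLp 2 (u k)‖) ⟨0, Finset.mem_range.2 hN⟩
  rw [Finset.mem_range] at hi
  set m := ‖WithLp.toLp 2 (u i)‖ with hm
  have hm0 : 0 ≤ m := norm_nonneg _
  have hall : ∀ k, ‖WithLp.toLp 2 (u k)‖ ≤ m := by
    intro k
    by_cases hk : k < N
    · exact hmax k (Finset.mem_range.2 hk)
    · rw [hu k (not_lt.1 hk)]; simpa using hm0
  have hprev : ‖WithLp.toLp 2 (if i = 0 then 0 else u (i - 1))‖ ≤ m := by
    split_ifs
    · simpa using hm0
    · exact hall _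
  have hz : m = 0 := by
    have hd := hdom (i + 1) (by omega) (by omega)
    have hc := hC (i + 1) (by omega) (by omega)
    have e : u i = (C (i + 1))⁻¹.mulVec ((C (i + 1)).mulVec (u i)) := by
      rw [Matrix.mulVec_mulVec, Matrix.nonsing_inv_mul _ ((Matrix.isUnit_iff_isUnit_det _).1 hc),
        Matrix.one_mulVec]
    have b1 : m ≤ opN M (C (i + 1))⁻¹ * ‖WithLp.toLp 2 ((C (i + 1)).mulVec (u i))‖ := by
      rw [hm]; conv_lhs => rw [e]
      exact opN_le _ _ _
    have b2 : ‖WithLp.toLp 2 ((C (i + 1)).mulVec (u i))‖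
        ≤ (opN M (A (i + 1)) + opN M (B (i + 1))) * m := by
      rw [hrow i hi, WithLp.toLp_add, add_mul]
      refine (norm_add_le _ _).trans (add_le_add ?_ ?_)
      · exact (opN_le _ _ _).trans (mul_le_mul_of_nonneg_left hprev (opN_nonneg _ _))
      · exact (opN_le _ _ _).trans (mul_le_mul_of_nonneg_left (hall _) (opN_nonneg _ _))
    have b3 := b1.trans (mul_le_mul_of_nonneg_left b2 (opN_nonneg _ _))
    nlinarith
  rw [← huv]
  ext p
  have h0 : WithLp.toLp 2 (u p.1) = 0 := norm_le_zero_iff.1 (hz ▸ hall p.1)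
  have h1 : u p.1 = 0 := by simpa using h0
  simp [h1]
end
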